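/- Let 0 < s < 1, 0 < β < s, and w(x) = (1 + |x|²)^{−β/2}. Define, for f with ∫_ℝ |f(x)|² w(x) dx < ∞, the operator T_s f(x) = ∫_ℝ (w(x) − w(y)) f(y) |x−y|^{−1−s/2} dy (absolutely convergent for almost every x). Then there exists C > 0 such that ∫_ℝ |T_s f(x)/w(x)|² w(x) dx ≤ C² ∫_ℝ |f(x)|² w(x) dx for all such f; i.e. the map f ↦ (1/w) T_s f is bounded from L²(w dx) to L²(w dx). -/

import Mathlib

open MeasureTheory

/-- The weight `w_β(x) = (1 + |x|²)^{−β/2}`. -/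
noncomputable def wbeta (β x : ℝ) : ℝ := (1 + x ^ 2) ^ (-(β / 2))

/-- The commutator `[Λ^{s/2}, w_β] f` realized (up to a positive normalizing constant) by
`T_s f(x) = ∫ (w_β(x) − w_β(y)) f(y) |x−y|^{−1−s/2} dy`. -/
noncomputable def commWeightS (β s : ℝ) (f : ℝ → ℝ) (x : ℝ) : ℝ :=
  ∫ y : ℝ, (wbeta β x - wbeta β y) * f y * |x - y| ^ (-(1 + s / 2))

/-- Radial profile of the integrable convolution majorant. -/
noncomputable def majM (s β t : ℝ) : ℝ :=
  if t ≤ 1 then t ^ (-(s / 2)) else 2 * t ^ (-(1 + (s - β) / 2))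

lemma measurable_majM (s β : ℝ) : Measurable (majM s β) := by
  unfold majM
  exact Measurable.ite measurableSet_Iic (by fun_prop) (by fun_prop)

lemma majM_nonneg (s β : ℝ) {t : ℝ} (ht : 0 ≤ t) : 0 ≤ majM s β t := by
  unfold majM
  split_ifs <;> positivity

lemma integrable_majM (s β : ℝ) (hs1 : s < 1) (hβs : β < s) :
    Integrable (fun h : ℝ => majM s β |h|) := by
  have h0 : IntegrableOn (fun t : ℝ => majM s β t) (Set.Ioi 0) := by
    rw [← Set.Ioc_union_Ioi_eq_Ioi (zero_le_one (α := ℝ))]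
    refine IntegrableOn.union ?_ ?_
    · have h1 : IntegrableOn (fun t : ℝ => t ^ (-(s / 2))) (Set.Ioc 0 1) := by
        rw [← intervalIntegrable_iff_integrableOn_Ioc_of_le zero_le_one]
        exact intervalIntegral.intervalIntegrable_rpow' (by linarith)
      refine h1.congr_fun (fun t ht => ?_) measurableSet_Ioc
      simp [majM, ht.2]
    · have h1 : IntegrableOn (fun t : ℝ => 2 * t ^ (-(1 + (s - β) / 2))) (Set.Ioi 1) :=
        (integrableOn_Ioi_rpow_of_lt (by linarith) one_pos).const_mul 2
      refine h1.congr_fun (fun t ht => ?_) measurableSet_Ioi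
      simp [majM, not_le.mpr (Set.mem_Ioi.mp ht)]
  have hf : IntegrableOn (fun t : ℝ => majM s β |t|) (Set.Ioi 0) := by
    refine h0.congr_fun (fun t ht => ?_) measurableSet_Ioi
    simp [abs_of_pos (Set.mem_Ioi.mp ht)]
  have int_Iic : IntegrableOn (fun t : ℝ => majM s β |t|) (Set.Iic 0) := by
    rw [← Measure.map_neg_eq_self (volume : Measure ℝ)]
    let m : MeasurableEmbedding fun x : ℝ => -x := (Homeomorph.neg ℝ).measurableEmbedding
    rw [m.integrableOn_map_iff]
    simp_rw [Function.comp_def, abs_neg, Set.neg_preimage, Set.neg_Iic, neg_zero]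
    exact Iff.mpr integrableOn_Ici_iff_integrableOn_Ioi hf
  have := int_Iic.union hf
  rwa [Set.Iic_union_Ioi, integrableOn_univ] at this

lemma log_lip (x y : ℝ) : |Real.log (1 + x ^ 2) - Real.log (1 + y ^ 2)| ≤ |x - y| := by
  have hd : ∀ z : ℝ, HasDerivAt (fun z : ℝ => Real.log (1 + z ^ 2)) (2 * z / (1 + z ^ 2)) z := by
    intro z
    have h1 : HasDerivAt (fun z : ℝ => 1 + z ^ 2) (2 * z) z := by
      simpa using (hasDerivAt_pow 2 z).const_add 1
    exact h1.log (by positivity)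
  have := Convex.norm_image_sub_le_of_norm_deriv_le (𝕜 := ℝ)
    (f := fun z : ℝ => Real.log (1 + z ^ 2)) (s := Set.univ) (x := y) (y := x) (C := 1)
    (fun z _ => (hd z).differentiableAt) (fun z _ => by
      rw [(hd z).deriv, Real.norm_eq_abs, abs_div, abs_of_pos (by positivity : 0 < 1 + z ^ 2),
        div_le_one (by positivity), abs_le]
      constructor <;> nlinarith [sq_nonneg (z + 1), sq_nonneg (z - 1)])
    convex_univ (Set.mem_univ _) (Set.mem_univ _)
  simpa using this

lemma log_large_aux (x y : ℝ) (h : 1 ≤ |x - y|) :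
    Real.log (1 + x ^ 2) - Real.log (1 + y ^ 2) ≤ 2 * Real.log 2 + 2 * Real.log |x - y| := by
  have h2 : 1 ≤ |x - y| ^ 2 := by nlinarith
  have key : 1 + x ^ 2 ≤ (2 ^ 2 * |x - y| ^ 2) * (1 + y ^ 2) := by
    have h3 : x ^ 2 ≤ 2 * y ^ 2 + 2 * |x - y| ^ 2 := by
      rw [sq_abs]; nlinarith [sq_nonneg (x - 2 * y)]
    nlinarith [mul_le_mul_of_nonneg_right h2 (sq_nonneg y)]
  have := Real.log_le_log (by positivity) key
  rw [Real.log_mul (by positivity) (by positivity), Real.log_mul (by positivity) (by positivity),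
    Real.log_pow, Real.log_pow] at this
  push_cast at this
  linarith

lemma log_large (x y : ℝ) (h : 1 ≤ |x - y|) :
    |Real.log (1 + x ^ 2) - Real.log (1 + y ^ 2)| ≤ 2 * Real.log 2 + 2 * Real.log |x - y| := by
  rw [abs_le]
  have h1 := log_large_aux x y h
  have h2 := log_large_aux y x (by rwa [abs_sub_comm])
  rw [abs_sub_comm y x] at h2
  constructor <;> linarith

lemma wbeta_pos (β x : ℝ) : 0 < wbeta β x := by
  unfold wbeta; positivity

lemma measurable_wbeta (β : ℝ) : Measurable (wbeta β) := by
  unfold wbeta; fun_prop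

lemma sqrt_wbeta (β x : ℝ) :
    Real.sqrt (wbeta β x) = Real.exp (-(β / 4) * Real.log (1 + x ^ 2)) := by
  unfold wbeta
  rw [Real.rpow_def_of_pos (by positivity), ← Real.exp_half]
  congr 1; ring

/-- Pointwise domination of the symmetrized kernel by a convolution kernel. -/
lemma kernel_bound (s β : ℝ) (hs1 : s < 1) (hβ0 : 0 < β) (hβs : β < s) (x y : ℝ) :
    |wbeta β x - wbeta β y| * |x - y| ^ (-(1 + s / 2)) ≤
      Real.sqrt (wbeta β x) * Real.sqrt (wbeta β y) * majM s β |x - y| := by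
  rcases eq_or_ne x y with rfl | hxy
  · simpa using mul_nonneg (mul_nonneg (Real.sqrt_nonneg (wbeta β x)) (Real.sqrt_nonneg (wbeta β x))) (majM_nonneg s β le_rfl)
  have hpos : 0 < |x - y| := abs_pos.mpr (sub_ne_zero.mpr hxy)
  set d : ℝ := (β / 4) * (Real.log (1 + y ^ 2) - Real.log (1 + x ^ 2)) with hd
  have hfac : |wbeta β x - wbeta β y| =
      Real.sqrt (wbeta β x) * Real.sqrt (wbeta β y) * |Real.exp d - Real.exp (-d)| := by
    rw [← abs_of_pos (mul_pos (Real.sqrt_pos.mpr (wbeta_pos β x))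
      (Real.sqrt_pos.mpr (wbeta_pos β y))), ← abs_mul]
    congr 1
    conv_lhs => rw [← Real.mul_self_sqrt (wbeta_pos β x).le, ← Real.mul_self_sqrt (wbeta_pos β y).le]
    simp only [sqrt_wbeta, mul_sub, ← Real.exp_add]
    congr 2 <;> rw [hd] <;> ring
  rw [hfac, mul_assoc]
  refine mul_le_mul_of_nonneg_left ?_ (by positivity)
  have habs : |d| = β / 4 * |Real.log (1 + x ^ 2) - Real.log (1 + y ^ 2)| := by
    rw [hd, abs_mul, abs_of_pos (by positivity : 0 < β / 4), abs_sub_comm]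
  unfold majM
  split_ifs with h1
  · have hd1 : |d| ≤ β / 4 * |x - y| := by
      rw [habs]; exact mul_le_mul_of_nonneg_left (log_lip x y) (by positivity)
    have hd2 : |d| ≤ 1 := by nlinarith
    have e1 := Real.abs_exp_sub_one_le hd2
    have e2 := Real.abs_exp_sub_one_le (x := -d) (by rwa [abs_neg])
    rw [abs_neg] at e2
    have e3 : |Real.exp d - Real.exp (-d)| ≤ |x - y| := by
      have : |Real.exp d - Real.exp (-d)| ≤ |Real.exp d - 1| + |Real.exp (-d) - 1| := by
        rw [abs_sub_comm (Real.exp (-d))]; exact abs_sub_le _ _ _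
      nlinarith
    calc _ ≤ |x - y| * |x - y| ^ (-(1 + s / 2)) := by gcongr
      _ = |x - y| ^ (-(s / 2)) := by
        conv_lhs => enter [1]; rw [← Real.rpow_one |x - y|]
        rw [← Real.rpow_add hpos]; congr 1; ring
  · push Not at h1
    have hd1 : |d| ≤ Real.log 2 + (β / 2) * Real.log |x - y| := by
      rw [habs]
      have := mul_le_mul_of_nonneg_left (log_large x y h1.le) (by positivity : 0 ≤ β / 4)
      have l2 : 0 < Real.log 2 := Real.log_pos (by norm_num)
      nlinarith
    have e3 : |Real.exp d - Real.exp (-d)| ≤ 2 * |x - y| ^ (β / 2) := by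
      calc |Real.exp d - Real.exp (-d)| ≤ Real.exp |d| := by
            have a1 := Real.exp_le_exp.mpr (le_abs_self d)
            have a2 := Real.exp_le_exp.mpr (neg_le_abs d)
            have a3 := Real.exp_pos d
            have a4 := Real.exp_pos (-d)
            rw [abs_le]; constructor <;> linarith
        _ ≤ Real.exp (Real.log 2 + (β / 2) * Real.log |x - y|) := Real.exp_le_exp.mpr hd1
        _ = 2 * |x - y| ^ (β / 2) := by
            rw [Real.exp_add, Real.exp_log (by norm_num), Real.rpow_def_of_pos hpos, mul_comm (β / 2)]
    calc _ ≤ 2 * |x - y| ^ (β / 2) * |x - y| ^ (-(1 + s / 2)) := by gcongr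
      _ = 2 * |x - y| ^ (-(1 + (s - β) / 2)) := by
        rw [mul_assoc, ← Real.rpow_add hpos]; congr 2; ring

open scoped ENNReal in
lemma cs_lintegral (K G : ℝ → ℝ≥0∞) (hK : Measurable K) (hG : Measurable G) :
    (∫⁻ y, K y * G y) ^ 2 ≤ (∫⁻ y, K y) * ∫⁻ y, K y * G y ^ 2 := by
  have h := ENNReal.lintegral_mul_le_Lp_mul_Lq (volume : Measure ℝ) (p := 2) (q := 2)
    (by constructor <;> norm_num)
    (f := fun y => K y ^ (1 / 2 : ℝ)) (g := fun y => K y ^ (1 / 2 : ℝ) * G y)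
    (by fun_prop) (by fun_prop)
  have hh : ∀ a : ℝ≥0∞, (a ^ (1 / 2 : ℝ)) ^ (2 : ℝ) = a := fun a => by
    rw [← ENNReal.rpow_mul]; norm_num
  have e1 : ∀ y, ((fun y => K y ^ (1 / 2 : ℝ)) * (fun y => K y ^ (1 / 2 : ℝ) * G y)) y
      = K y * G y := fun y => by
    simp only [Pi.mul_apply]
    rw [← mul_assoc, ← ENNReal.rpow_add_of_nonneg _ _ (by norm_num) (by norm_num)]
    norm_num
  simp only [e1, hh, ENNReal.mul_rpow_of_nonneg _ _ (zero_le_two (α := ℝ))] at h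
  calc (∫⁻ y, K y * G y) ^ 2 = (∫⁻ y, K y * G y) ^ (2 : ℝ) := by norm_num
    _ ≤ _ := ENNReal.rpow_le_rpow h zero_le_two
    _ = _ := by
      rw [ENNReal.mul_rpow_of_nonneg _ _ zero_le_two, hh, hh]
      simp

open scoped ENNReal in
/-- Young's inequality `L¹ * L² ⊆ L²`. -/
lemma young_lintegral (K G : ℝ → ℝ≥0∞) (hK : Measurable K) (hG : Measurable G) :
    ∫⁻ x, (∫⁻ y, K (x - y) * G y) ^ 2 ≤ (∫⁻ y, K y) ^ 2 * ∫⁻ y, G y ^ 2 := by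
  calc ∫⁻ x, (∫⁻ y, K (x - y) * G y) ^ 2
      ≤ ∫⁻ x, (∫⁻ y, K y) * ∫⁻ y, K (x - y) * G y ^ 2 := by
        refine lintegral_mono fun x => ?_
        have := cs_lintegral (fun y => K (x - y)) G (by fun_prop) hG
        rwa [lintegral_sub_left_eq_self K x] at this
    _ = (∫⁻ y, K y) * ∫⁻ x, ∫⁻ y, K (x - y) * G y ^ 2 := by
        refine lintegral_const_mul _ ?_
        exact Measurable.lintegral_prod_right (by unfold Function.uncurry; fun_prop)
    _ = (∫⁻ y, K y) * ∫⁻ y, ∫⁻ x, K (x - y) * G y ^ 2 := by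
        rw [lintegral_lintegral_swap]
        exact Measurable.aemeasurable (by unfold Function.uncurry; fun_prop)
    _ = (∫⁻ y, K y) * ∫⁻ y, (∫⁻ x, K x) * G y ^ 2 := by
        congr 1
        refine lintegral_congr fun y => ?_
        rw [lintegral_mul_const _ (by fun_prop), lintegral_sub_right_eq_self K y]
    _ = _ := by
        rw [lintegral_const_mul _ (by fun_prop), ← mul_assoc, sq]

/-- For `0 < s < 1` and `0 < β < s`, the map `f ↦ (1/w_β) [Λ^{s/2}, w_β] f` is bounded
from `L²(w_β dx)` to `L²(w_β dx)`, the defining integral converging absolutely for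
almost every `x`. -/
theorem commutator_weight_s_bounded (s β : ℝ) (hs0 : 0 < s) (hs1 : s < 1)
    (hβ0 : 0 < β) (hβs : β < s) :
    ∃ C > 0, ∀ f : ℝ → ℝ, Measurable f →
      Integrable (fun x : ℝ => |f x| ^ 2 * wbeta β x) →
      (∀ᵐ x : ℝ, Integrable (fun y : ℝ =>
          (wbeta β x - wbeta β y) * f y * |x - y| ^ (-(1 + s / 2)))) ∧
      Integrable (fun x : ℝ => |commWeightS β s f x / wbeta β x| ^ 2 * wbeta β x) ∧
      (∫ x : ℝ, |commWeightS β s f x / wbeta β x| ^ 2 * wbeta β x) ≤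
        C ^ 2 * ∫ x : ℝ, |f x| ^ 2 * wbeta β x := by
  have hMint := integrable_majM s β hs1 hβs
  have hM0 : ∀ h : ℝ, 0 ≤ majM s β |h| := fun h => majM_nonneg s β (abs_nonneg h)
  have hMmeas := measurable_majM s β
  have hwm := measurable_wbeta β
  set A : ℝ := ∫ h : ℝ, majM s β |h| with hA
  have hA0 : 0 ≤ A := integral_nonneg hM0
  have hAl : ENNReal.ofReal A = ∫⁻ h : ℝ, ENNReal.ofReal (majM s β |h|) :=
    ofReal_integral_eq_lintegral_ofReal hMint (Filter.Eventually.of_forall hM0)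
  refine ⟨A + 1, by linarith, fun f hf hfi => ?_⟩
  set I : ℝ := ∫ x : ℝ, |f x| ^ 2 * wbeta β x with hI
  have hI0 : 0 ≤ I := integral_nonneg fun x => mul_nonneg (sq_nonneg _) (wbeta_pos β x).le
  set G : ℝ → ENNReal := fun y => ENNReal.ofReal (|f y| * Real.sqrt (wbeta β y)) with hG
  set K : ℝ → ENNReal := fun h => ENNReal.ofReal (majM s β |h|) with hK
  have hGm : Measurable G := by fun_prop
  have hKm : Measurable K := by fun_prop
  have hG2 : ∫⁻ y, G y ^ 2 = ENNReal.ofReal I := by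
    rw [hI, ofReal_integral_eq_lintegral_ofReal hfi
      (Filter.Eventually.of_forall fun x => mul_nonneg (sq_nonneg _) (wbeta_pos β x).le)]
    refine lintegral_congr fun y => ?_
    rw [hG, ← ENNReal.ofReal_pow (by positivity), mul_pow, Real.sq_sqrt (wbeta_pos β y).le]
  set u : ℝ → ENNReal := fun x => ∫⁻ y, K (x - y) * G y with hu
  have hum : Measurable u :=
    Measurable.lintegral_prod_right (by unfold Function.uncurry; fun_prop)
  have hu2 : ∫⁻ x, u x ^ 2 ≤ ENNReal.ofReal (A ^ 2 * I) := by
    have := young_lintegral K G hKm hGm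
    rwa [hG2, ← hAl, ← ENNReal.ofReal_pow hA0, ← ENNReal.ofReal_mul (by positivity)] at this
  -- pointwise kernel bound
  have hF : ∀ x y : ℝ, ‖(wbeta β x - wbeta β y) * f y * |x - y| ^ (-(1 + s / 2))‖ₑ ≤
      ENNReal.ofReal (Real.sqrt (wbeta β x)) * (K (x - y) * G y) := by
    intro x y
    rw [Real.enorm_eq_ofReal_abs, hK, hG, ← ENNReal.ofReal_mul (hM0 _),
      ← ENNReal.ofReal_mul (Real.sqrt_nonneg _)]
    refine ENNReal.ofReal_le_ofReal ?_
    rw [abs_mul, abs_mul, abs_of_nonneg (by positivity : 0 ≤ |x - y| ^ (-(1 + s / 2)))]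
    have := mul_le_mul_of_nonneg_right (kernel_bound s β hs1 hβ0 hβs x y) (abs_nonneg (f y))
    calc _ = |wbeta β x - wbeta β y| * |x - y| ^ (-(1 + s / 2)) * |f y| := by ring
      _ ≤ _ := this
      _ = _ := by ring
  have hFi : ∀ x : ℝ, ∫⁻ y, ‖(wbeta β x - wbeta β y) * f y * |x - y| ^ (-(1 + s / 2))‖ₑ ≤
      ENNReal.ofReal (Real.sqrt (wbeta β x)) * u x := by
    intro x
    refine (lintegral_mono (hF x)).trans_eq ?_
    rw [lintegral_const_mul _ (by fun_prop)]
  have hTm : Measurable (commWeightS β s f) := by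
    have : StronglyMeasurable (fun x => ∫ y : ℝ,
        (wbeta β x - wbeta β y) * f y * |x - y| ^ (-(1 + s / 2))) :=
      StronglyMeasurable.integral_prod_right
        (Measurable.stronglyMeasurable (by unfold Function.uncurry; fun_prop))
    exact this.measurable
  have hpt : ∀ x, ENNReal.ofReal (|commWeightS β s f x / wbeta β x| ^ 2 * wbeta β x) ≤ u x ^ 2 := by
    intro x
    have hw := wbeta_pos β x
    have hsq : 0 < Real.sqrt (wbeta β x) := Real.sqrt_pos.mpr hw
    have h1 : ENNReal.ofReal |commWeightS β s f x| ≤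
        ENNReal.ofReal (Real.sqrt (wbeta β x)) * u x := by
      rw [← Real.enorm_eq_ofReal_abs]
      exact (enorm_integral_le_lintegral_enorm _).trans (hFi x)
    have h2 : |commWeightS β s f x / wbeta β x| ^ 2 * wbeta β x =
        ((Real.sqrt (wbeta β x))⁻¹ * |commWeightS β s f x|) ^ 2 := by
      rw [abs_div, abs_of_pos hw, mul_pow, inv_pow, Real.sq_sqrt hw.le]
      field_simp
    rw [h2, ENNReal.ofReal_pow (by positivity), ENNReal.ofReal_mul (by positivity)]
    gcongr
    calc _ ≤ ENNReal.ofReal (Real.sqrt (wbeta β x))⁻¹ *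
          (ENNReal.ofReal (Real.sqrt (wbeta β x)) * u x) := by gcongr
      _ = u x := by
        rw [← mul_assoc, ← ENNReal.ofReal_mul (by positivity), inv_mul_cancel₀ hsq.ne']
        simp
  have hle : ∫⁻ x, ENNReal.ofReal (|commWeightS β s f x / wbeta β x| ^ 2 * wbeta β x) ≤
      ENNReal.ofReal (A ^ 2 * I) := (lintegral_mono hpt).trans hu2
  have hnn : ∀ x, 0 ≤ |commWeightS β s f x / wbeta β x| ^ 2 * wbeta β x :=
    fun x => mul_nonneg (sq_nonneg _) (wbeta_pos β x).le
  have hmeas : Measurable fun x => |commWeightS β s f x / wbeta β x| ^ 2 * wbeta β x := by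
    fun_prop
  refine ⟨?_, ?_, ?_⟩
  · have h1 := ae_lt_top (μ := volume) (f := fun x => u x ^ 2) (by fun_prop)
      (hu2.trans_lt ENNReal.ofReal_lt_top).ne
    filter_upwards [h1] with x hx
    have hx' : u x < ⊤ := by
      by_contra h
      rw [not_lt, top_le_iff] at h
      simp [h] at hx
    refine ⟨Measurable.aestronglyMeasurable (by fun_prop), ?_⟩
    exact (hFi x).trans_lt (ENNReal.mul_lt_top ENNReal.ofReal_lt_top hx')
  · refine ⟨hmeas.aestronglyMeasurable, ?_⟩
    rw [hasFiniteIntegral_iff_ofReal (Filter.Eventually.of_forall hnn)]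
    exact hle.trans_lt ENNReal.ofReal_lt_top
  · rw [integral_eq_lintegral_of_nonneg_ae (Filter.Eventually.of_forall hnn)
      hmeas.aestronglyMeasurable]
    refine (ENNReal.toReal_le_of_le_ofReal (by positivity) hle).trans ?_
    gcongr
    linarith
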